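/- arXiv:2209.08491 — 2 statements merged into one kernel-verified Lean document; each statement's English description precedes it below -/
import Mathlib

section
/- For any state $|\psi\rangle$ in a finite-dimensional Hilbert space and any Hermitian involutions $A_1, A_2, B_1, B_2$ with $[A_i, B_j] = 0$ for all $i,j$, the Tsirelson bound holds: $|\langle\psi| A_1 B_1 + A_1 B_2 + A_2 B_1 - A_2 B_2 |\psi\rangle| \le 2\sqrt{2}$. -/
open Matrix

open scoped MatrixOrder ComplexOrder in
/-- The quadratic form of the CHSH operator of a CHSH tuple of matrices is at most `2√2`
on unit vectors. -/
lemma IsCHSHTuple.re_dotProduct_mulVec_le {n : Type*} [Fintype n] [DecidableEq n]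
    {A₁ A₂ B₁ B₂ : Matrix n n ℂ} (T : IsCHSHTuple A₁ A₂ B₁ B₂)
    {ψ : n → ℂ} (hψ : star ψ ⬝ᵥ ψ = 1) :
    (star ψ ⬝ᵥ ((A₁ * B₁ + A₁ * B₂ + A₂ * B₁ - A₂ * B₂) *ᵥ ψ)).re ≤ 2 * √2 := by
  have h := (Matrix.le_iff.mp (tsirelson_inequality A₁ A₂ B₁ B₂ T)).re_dotProduct_nonneg ψ
  have h3 : √2 ^ 3 = 2 * √2 := by
    rw [pow_succ, Real.sq_sqrt zero_le_two]
  rw [sub_mulVec, dotProduct_sub, smul_mulVec, one_mulVec, dotProduct_smul, hψ, h3] at h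
  simpa using h

/-- the Tsirelson bound.  For any unit vector `ψ` in a finite-dimensional
Hilbert space (here `Fin n → ℂ`) and any Hermitian involutions `A₁ A₂ B₁ B₂` with all
`Aᵢ` commuting with all `Bⱼ`, the CHSH operator expectation is bounded by `2√2`. -/
theorem tsirelson_bound (n : ℕ)
    (ψ : Fin n → ℂ) (A₁ A₂ B₁ B₂ : Matrix (Fin n) (Fin n) ℂ)
    (hψ : star ψ ⬝ᵥ ψ = 1)
    (hA₁ : A₁.IsHermitian) (hA₂ : A₂.IsHermitian)
    (hB₁ : B₁.IsHermitian) (hB₂ : B₂.IsHermitian)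
    (hA₁i : A₁ * A₁ = 1) (hA₂i : A₂ * A₂ = 1)
    (hB₁i : B₁ * B₁ = 1) (hB₂i : B₂ * B₂ = 1)
    (hc11 : A₁ * B₁ = B₁ * A₁) (hc12 : A₁ * B₂ = B₂ * A₁)
    (hc21 : A₂ * B₁ = B₁ * A₂) (hc22 : A₂ * B₂ = B₂ * A₂) :
    ‖star ψ ⬝ᵥ ((A₁ * B₁ + A₁ * B₂ + A₂ * B₁ - A₂ * B₂).mulVec ψ)‖
      ≤ 2 * Real.sqrt 2 := by
  have T : IsCHSHTuple A₁ A₂ B₁ B₂ :=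
    { A₀_inv := by rw [sq, hA₁i]
      A₁_inv := by rw [sq, hA₂i]
      B₀_inv := by rw [sq, hB₁i]
      B₁_inv := by rw [sq, hB₂i]
      A₀_sa := hA₁
      A₁_sa := hA₂
      B₀_sa := hB₁
      B₁_sa := hB₂
      A₀B₀_commutes := hc11
      A₀B₁_commutes := hc12
      A₁B₀_commutes := hc21
      A₁B₁_commutes := hc22 }
  have T' : IsCHSHTuple (-A₁) (-A₂) B₁ B₂ :=
    { T with
      A₀_inv := by rw [neg_sq, T.A₀_inv]
      A₁_inv := by rw [neg_sq, T.A₁_inv]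
      A₀_sa := by rw [star_neg, T.A₀_sa]
      A₁_sa := by rw [star_neg, T.A₁_sa]
      A₀B₀_commutes := by rw [neg_mul, mul_neg, hc11]
      A₀B₁_commutes := by rw [neg_mul, mul_neg, hc12]
      A₁B₀_commutes := by rw [neg_mul, mul_neg, hc21]
      A₁B₁_commutes := by rw [neg_mul, mul_neg, hc22] }
  have hle := T.re_dotProduct_mulVec_le hψ
  have hge := T'.re_dotProduct_mulVec_le hψ
  have hneg : -A₁ * B₁ + -A₁ * B₂ + -A₂ * B₁ - -A₂ * B₂
      = -(A₁ * B₁ + A₁ * B₂ + A₂ * B₁ - A₂ * B₂) := by noncomm_ring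
  rw [hneg, neg_mulVec, dotProduct_neg, Complex.neg_re] at hge
  have hH : (A₁ * B₁ + A₁ * B₂ + A₂ * B₁ - A₂ * B₂).IsHermitian :=
    (((hA₁.commute_iff hB₁).mp hc11).add ((hA₁.commute_iff hB₂).mp hc12)).add
      ((hA₂.commute_iff hB₁).mp hc21) |>.sub ((hA₂.commute_iff hB₂).mp hc22)
  have him := hH.im_star_dotProduct_mulVec_self ψ
  rw [← Complex.abs_re_eq_norm.mpr him]
  exact abs_le.mpr ⟨by linarith, hle⟩
end

section
/- Routing bound (Alon et al.): for any connected graph $G$ on $n$ vertices and any permutation $\pi$ of the vertices, $\pi$ can be realized as a composition of at most $3n$ rounds of transpositions along edges of $G$ (each round consisting of disjoint edge-transpositions). Consequently, any quantum circuit with $g$ two-qubit gates on $n$ qubits arranged on $G$ can be implemented with gate-count overhead at most a multiplicative factor of $3n$. -/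
/-- A "round" of routing on a graph `G`: a permutation that is a product of
vertex-disjoint transpositions along edges of `G`, i.e. every vertex is either
fixed, or swapped with an adjacent vertex. -/
def IsRound {V : Type*} (G : SimpleGraph V) (σ : Equiv.Perm V) : Prop :=
  ∀ v, σ v = v ∨ (G.Adj v (σ v) ∧ σ (σ v) = v)

open Equiv

/-- A tree on `V` given by a root, a parent map and a compatible depth function. -/
structure ParentTree (V : Type*) where
  root : V
  parent : V → V
  depth : V → ℕ
  depth_root : depth root = 0
  depth_parent : ∀ x, x ≠ root → depth (parent x) + 1 = depth x

namespace ParentTree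

variable {V : Type*} (T : ParentTree V)

lemma depth_pos {x : V} (hx : x ≠ T.root) : 0 < T.depth x := by
  have := T.depth_parent x hx
  omega

lemma ne_root_of_depth_pos {x : V} (hx : 0 < T.depth x) : x ≠ T.root := by
  rintro rfl
  simp [T.depth_root] at hx

/-- The ancestor of `x` at depth `e`, or `x` itself if `x` is not deeper than `e`. -/
def ancestor (e : ℕ) (x : V) : V := T.parent^[T.depth x - e] x

lemma ancestor_of_le {e : ℕ} {x : V} (h : T.depth x ≤ e) : T.ancestor e x = x := by
  simp [ancestor, Nat.sub_eq_zero_of_le h]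

lemma ancestor_parent {e : ℕ} {x : V} (h : e < T.depth x) :
    T.ancestor e (T.parent x) = T.ancestor e x := by
  have := T.depth_parent x (T.ne_root_of_depth_pos (by omega))
  rw [ancestor, ancestor, show T.depth x - e = (T.depth (T.parent x) - e) + 1 by omega,
    Function.iterate_succ_apply]

lemma parent_ancestor {e : ℕ} {x : V} (h : e < T.depth x) :
    T.parent (T.ancestor (e + 1) x) = T.ancestor e x := by
  rw [ancestor, ancestor, show T.depth x - e = (T.depth x - (e + 1)) + 1 by omega,
    Function.iterate_succ_apply']

lemma depth_ancestor {e : ℕ} {x : V} (h : e ≤ T.depth x) : T.depth (T.ancestor e x) = e := by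
  induction hk : T.depth x - e generalizing x with
  | zero => rw [T.ancestor_of_le (by omega)]; omega
  | succ k ih =>
    have := T.depth_parent x (T.ne_root_of_depth_pos (by omega))
    rw [← T.ancestor_parent (by omega)]
    exact ih (by omega) (by omega)

lemma ancestor_zero (x : V) : T.ancestor 0 x = T.root := by
  by_contra h
  have := T.depth_pos h
  rw [T.depth_ancestor (Nat.zero_le _)] at this
  omega

end ParentTree

section Schedule

variable {V : Type*} {G : SimpleGraph V}

lemma IsRound.inv {σ : Perm V} (h : IsRound G σ) : IsRound G σ⁻¹ := by
  intro v
  rcases h v with h₁ | ⟨h₁, h₂⟩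
  · left
    rw [Perm.inv_eq_iff_eq, h₁]
  · have h₃ : σ⁻¹ v = σ v := by rw [Perm.inv_eq_iff_eq, h₂]
    right
    rw [h₃, Perm.inv_eq_iff_eq]
    exact ⟨h₁, rfl⟩

lemma IsRound.one : IsRound G 1 := fun _ => Or.inl rfl

lemma IsRound.swap [DecidableEq V] {x y : V} (h : G.Adj x y) : IsRound G (Equiv.swap x y) := by
  intro v
  by_cases hx : v = x
  · subst hx; simp [h]
  by_cases hy : v = y
  · subst hy; simp [h.symm]
  exact Or.inl (swap_apply_of_ne_of_ne hx hy)

lemma IsRound.mul {σ τ : Perm V} (hσ : IsRound G σ) (hτ : IsRound G τ) (h : σ.Disjoint τ) :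
    IsRound G (σ * τ) := by
  intro v
  rcases h v with h₁ | h₁
  · rcases hτ v with h₂ | ⟨h₂, h₃⟩
    · left; simp [h₁, h₂]
    · right
      have h₄ : σ (τ v) = τ v := by
        rcases h (τ v) with h₄ | h₄
        · exact h₄
        · rw [τ.injective h₄, h₁]
      simp [h₃, h₄, h₂, h₁]
  · rcases hσ v with h₂ | ⟨h₂, h₃⟩
    · left; simp [h₁, h₂]
    · right
      have h₄ : τ (σ v) = σ v := by
        rcases h (σ v) with h₄ | h₄
        · rw [σ.injective h₄, h₁]
        · exact h₄
      simp [h₁, h₂, h₃, h₄]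

lemma IsRound.list_prod {α : Type*} {f : α → Perm V} {l : List α}
    (hf : ∀ a ∈ l, IsRound G (f a)) (hl : l.Pairwise fun a b => (f a).Disjoint (f b)) :
    IsRound G (l.map f).prod := by
  induction l with
  | nil => exact IsRound.one
  | cons a l ih =>
    rw [List.pairwise_cons] at hl
    rw [List.map_cons, List.prod_cons]
    refine (hf a (by simp)).mul (ih (fun b hb => hf b (by simp [hb])) hl.2)
      (Perm.disjoint_prod_right _ ?_)
    intro g hg
    obtain ⟨b, hb, rfl⟩ := List.mem_map.1 hg
    exact hl.1 b hb

/-- A sequence of rounds carrying time stamps, where rounds that are not disjoint occur in the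
order of their time stamps, can be executed in parallel according to the time stamps. -/
lemma exists_rounds_of_schedule {α : Type*} (t : α → ℤ) (f : α → Perm V) (N : ℕ) (l : List α)
    (lo : ℤ) (hf : ∀ a ∈ l, IsRound G (f a))
    (hl : l.Pairwise fun a b => t a < t b ∨ (f a).Disjoint (f b))
    (ht : ∀ a ∈ l, lo ≤ t a ∧ t a < lo + N) :
    ∃ L : List (Perm V), L.length = N ∧ (∀ σ ∈ L, IsRound G σ) ∧ L.prod = (l.map f).prod := by
  induction N generalizing l lo with
  | zero =>
    have : l = [] := List.eq_nil_iff_forall_not_mem.2 fun a ha => by have := ht a ha; omega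
    subst this
    exact ⟨[], by simp⟩
  | succ N ih =>
    have key : (l.map f).prod = ((l.filter (t · = lo)).map f).prod *
        ((l.filter (t · ≠ lo)).map f).prod := by
      clear ih hf
      induction l with
      | nil => simp
      | cons a l ih =>
        rw [List.pairwise_cons] at hl
        have ih := ih hl.2 (fun b hb => ht b (by simp [hb]))
        by_cases ha : t a = lo
        · simp [ha, ih, mul_assoc]
        · have hc : Commute (f a) ((l.filter (t · = lo)).map f).prod := by
            refine Perm.Disjoint.commute (Perm.disjoint_prod_right _ ?_)
            intro g hg
            obtain ⟨b, hb, rfl⟩ := List.mem_map.1 hg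
            simp only [List.mem_filter, decide_eq_true_eq] at hb
            have := ht a (by simp)
            refine (hl.1 b hb.1).resolve_left (by omega)
          simp only [ne_eq, decide_not, ha, decide_false, Bool.false_eq_true, not_false_eq_true,
            List.filter_cons_of_neg, List.map_cons, List.prod_cons, Bool.not_false,
            List.filter_cons_of_pos] at ih ⊢
          rw [ih, ← mul_assoc, hc.eq, mul_assoc]
    obtain ⟨L, hL, hR, hp⟩ := ih (l.filter (t · ≠ lo)) (lo + 1)
      (fun a ha => hf a (List.mem_of_mem_filter ha)) (hl.filter _) (by
        intro a ha
        simp only [List.mem_filter, decide_eq_true_eq] at ha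
        have := ht a ha.1
        push_cast at this
        omega)
    refine ⟨((l.filter (t · = lo)).map f).prod :: L, by simp [hL], ?_, ?_⟩
    · rintro σ hσ
      rcases List.mem_cons.1 hσ with rfl | hσ
      · refine IsRound.list_prod (fun a ha => hf a (List.mem_of_mem_filter ha)) ?_
        refine (hl.filter _).imp_of_mem ?_
        intro a b ha hb hab
        simp only [List.mem_filter, decide_eq_true_eq] at ha hb
        exact hab.resolve_left (by omega)
      · exact hR σ hσ
    · rw [List.prod_cons, hp, key]

end Schedule

namespace ParentTree

variable {V ι : Type*} [DecidableEq V] (T : ParentTree V) (ℓ : V → ι)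

/-- The transposition along the edge between `w` and its parent. -/
def swapUp (w : V) : Perm V := swap (T.parent w) w

/-- The labels are constant along the edges of the tree that do not contain the root. -/
def Respects : Prop := ∀ x, x ≠ T.root → T.parent x = T.root ∨ ℓ (T.parent x) = ℓ x

/-- A sufficient condition for two edge transpositions `(τ, w)`, read as swapping `w` with its
parent at time `τ + depth w`, to be executable in this order. -/
def Follows (a b : ℤ × V) : Prop :=
  a.1 + 2 ≤ b.1 ∨ (a.1 < b.1 ∧ ℓ a.2 ≠ ℓ b.2) ∨ (a.1 = b.1 ∧ T.depth a.2 < T.depth b.2) ∨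
    (a.1 = b.1 ∧ ∃ e, e < T.depth a.2 ∧ e < T.depth b.2 ∧ T.ancestor e a.2 ≠ T.ancestor e b.2)

variable {T ℓ}

lemma Follows.lt_or_disjoint (hℓ : T.Respects ℓ) {a b : ℤ × V} (h : T.Follows ℓ a b)
    (ha : a.2 ≠ T.root) (hb : b.2 ≠ T.root) :
    a.1 + T.depth a.2 < b.1 + T.depth b.2 ∨ (T.swapUp a.2).Disjoint (T.swapUp b.2) := by
  obtain ⟨τ, x⟩ := a
  obtain ⟨τ', y⟩ := b
  simp only [Follows] at *
  have hx := T.depth_parent x ha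
  have hy := T.depth_parent y hb
  by_cases hd : T.parent x ≠ x ∧ T.parent x ≠ T.parent y ∧ T.parent x ≠ y ∧ x ≠ T.parent y ∧
      x ≠ y ∧ T.parent y ≠ y
  · right
    apply Perm.disjoint_swap_swap
    simp only [List.nodup_cons, List.mem_cons, List.not_mem_nil, or_false, not_or,
      not_false_eq_true, List.nodup_nil, and_true]
    tauto
  left
  have h₁ : T.parent x ≠ x := fun h => by rw [h] at hx; omega
  have h₂ : T.parent y ≠ y := fun h => by rw [h] at hy; omega
  have hs : T.parent x = T.parent y ∨ T.parent x = y ∨ x = T.parent y ∨ x = y := by tauto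
  rcases h with h | ⟨h, hl⟩ | h | ⟨h, e, hex, hey, he⟩
  · rcases hs with hs | hs | hs | hs
    · rw [hs] at hx; omega
    · rw [hs] at hx; omega
    · rw [← hs] at hy; omega
    · rw [hs]; omega
  · rcases hs with hs | hs | hs | hs
    · rw [hs] at hx; omega
    · rcases hℓ x ha with h' | h'
      · exact absurd (hs.symm.trans h') hb
      · exact absurd (hs ▸ h').symm hl
    · rcases hℓ y hb with h' | h'
      · exact absurd (hs.trans h') ha
      · exact absurd (hs ▸ h') hl
    · exact absurd (by rw [hs]) hl
  · omega
  · exfalso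
    rcases hs with hs | hs | hs | hs
    · exact he (by rw [← T.ancestor_parent hex, hs, T.ancestor_parent hey])
    · exact he (by rw [← T.ancestor_parent hex, hs])
    · exact he (by rw [← T.ancestor_parent hey, hs])
    · exact he (by rw [hs])

/-- Let the token at `u` have label `i`. Move it down from `u` along vertices of label `i` whose
tokens have a different label, as long as there are such children. -/
lemma exists_descent [Finite V] (i : ι) (c : Perm V) (u : V)
    (hu : ℓ (c u) = i) :
    ∃ (L : List V) (d : V),
      (∀ w ∈ L, w ≠ T.root ∧ ℓ w = i ∧ ℓ (c w) ≠ i ∧ T.depth u < T.depth w ∧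
        T.depth w ≤ T.depth u + L.length ∧ T.ancestor (T.depth u) w = u) ∧
      L.Pairwise (fun x y => T.depth x < T.depth y) ∧
      (∀ v, v ≠ u → (ℓ ((c * (L.map T.swapUp).prod) v) ≠ ℓ v ↔ ℓ (c v) ≠ ℓ v ∧ v ≠ d)) ∧
      (∀ w, w ≠ T.root → T.parent w = d → ℓ w = i → ℓ (c w) = i) ∧
      ((L = [] ∧ d = u) ∨ (ℓ ((c * (L.map T.swapUp).prod) u) ≠ i ∧ d ∈ L)) ∧
      (∀ v, T.depth v < T.depth u → (c * (L.map T.swapUp).prod) v = c v) := by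
  obtain ⟨D, hD⟩ := (Set.finite_range T.depth).bddAbove
  have hD : ∀ v, T.depth v ≤ D := fun v => hD ⟨v, rfl⟩
  induction hk : D - T.depth u using Nat.strong_induction_on generalizing c u with
  | _ k ih =>
  by_cases hw : ∃ w, w ≠ T.root ∧ T.parent w = u ∧ ℓ w = i ∧ ℓ (c w) ≠ i
  swap
  · push Not at hw
    refine ⟨[], u, by simp, by simp, ?_, hw, by simp, by simp⟩
    intro v hv
    simp [hv]
  obtain ⟨w, hw₀, hwu, hwi, hcw⟩ := hw
  have hdw := T.depth_parent w hw₀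
  rw [hwu] at hdw
  have huw : u ≠ w := by rintro rfl; omega
  have hDw := hD w
  have e₁ : (c * T.swapUp w) w = c u := by simp [swapUp, hwu]
  have e₂ : (c * T.swapUp w) u = c w := by simp [swapUp, hwu]
  have e₃ : ∀ v, v ≠ u → v ≠ w → (c * T.swapUp w) v = c v := fun v h h' => by
    simp [swapUp, hwu, swap_apply_of_ne_of_ne h h']
  obtain ⟨L, d, h₁, h₂, h₃, h₄, h₅, h₆⟩ := ih (D - T.depth w) (by omega) (c * T.swapUp w) w
    (by rw [e₁, hu]) rfl
  have hne : ∀ x, T.depth w < T.depth x → x ≠ u ∧ x ≠ w := fun x hx =>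
    ⟨by rintro rfl; omega, by rintro rfl; omega⟩
  have hdd : d = w ∨ T.depth w < T.depth d := by
    rcases h₅ with h | h
    · exact Or.inl h.2
    · exact Or.inr (h₁ d h.2).2.2.2.1
  refine ⟨w :: L, d, ?_, ?_, ?_, ?_, ?_, ?_⟩
  · intro x hx
    rcases List.mem_cons.1 hx with rfl | hx
    · refine ⟨hw₀, hwi, hcw, by omega, by simp; omega, ?_⟩
      rw [← T.ancestor_parent (by omega), hwu, T.ancestor_of_le le_rfl]
    · obtain ⟨a₁, a₂, a₃, a₄, a₅, a₆⟩ := h₁ x hx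
      have := hne x a₄
      rw [e₃ x this.1 this.2] at a₃
      refine ⟨a₁, a₂, a₃, by omega, by simp; omega, ?_⟩
      rw [← T.parent_ancestor (by omega), hdw, a₆, hwu]
  · exact List.pairwise_cons.2 ⟨fun x hx => (h₁ x hx).2.2.2.1, h₂⟩
  · intro v hv
    rw [List.map_cons, List.prod_cons, ← mul_assoc]
    by_cases hvw : v = w
    · subst hvw
      rcases h₅ with ⟨rfl, rfl⟩ | ⟨h, hdL⟩
      · simp [swapUp, hwu, hu, hwi]
      · have : v ≠ d := by
          rintro rfl
          exact absurd (h₁ v hdL).2.2.2.1 (lt_irrefl _)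
        rw [hwi]
        exact ⟨fun _ => ⟨hcw, this⟩, fun _ => h⟩
    · rw [h₃ v hvw, e₃ v hv hvw]
  · intro x hx₀ hxd hxi
    have := T.depth_parent x hx₀
    rw [hxd] at this
    have hx := hne x (by rcases hdd with rfl | h <;> omega)
    have := h₄ x hx₀ hxd hxi
    rwa [e₃ x hx.1 hx.2] at this
  · right
    rw [List.map_cons, List.prod_cons, ← mul_assoc, h₆ u (by omega), e₂]
    refine ⟨hcw, ?_⟩
    rcases h₅ with h | h
    · simp [h.2]
    · simp [h.2]
  · intro v hv
    rw [List.map_cons, List.prod_cons, ← mul_assoc, h₆ v (by omega),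
      e₃ v (by rintro rfl; omega) (by rintro rfl; omega)]

variable [Fintype V] [DecidableEq ι]

omit [DecidableEq V] in
lemma card_filter_label_perm (c : Perm V) (i : ι) :
    (Finset.univ.filter fun v => ℓ (c v) = i).card = (Finset.univ.filter fun v => ℓ v = i).card :=
  Finset.card_equiv c (by simp)

omit [DecidableEq V] in
/-- As many tokens of label `i` are outside the fiber of `i` as there are tokens of other labels
inside. -/
lemma card_improper_eq (c : Perm V) (i : ι) :
    (Finset.univ.filter fun v => ℓ v = i ∧ ℓ (c v) ≠ i).card =
      (Finset.univ.filter fun v => ℓ v ≠ i ∧ ℓ (c v) = i).card := by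
  have h₁ := Finset.card_filter_add_card_filter_not
    (s := Finset.univ.filter fun v => ℓ v = i) (fun v => ℓ (c v) = i)
  have h₂ := Finset.card_filter_add_card_filter_not
    (s := Finset.univ.filter fun v => ℓ (c v) = i) (fun v => ℓ v = i)
  rw [card_filter_label_perm] at h₂
  simp only [Finset.filter_filter] at h₁ h₂
  have e : (Finset.univ.filter fun v => ℓ (c v) = i ∧ ℓ v = i) =
      (Finset.univ.filter fun v => ℓ v = i ∧ ℓ (c v) = i) := by
    ext; simp [and_comm]
  have e' : (Finset.univ.filter fun v => ℓ (c v) = i ∧ ¬ ℓ v = i) =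
      (Finset.univ.filter fun v => ℓ v ≠ i ∧ ℓ (c v) = i) := by
    ext; simp [and_comm]
  rw [e, e'] at h₂
  simp only [ne_eq] at *
  omega

omit [DecidableEq V] in
lemma exists_improper_of_misplaced (c : Perm V) {i : ι} {x : V} (hx : ℓ x ≠ i)
    (hcx : ℓ (c x) = i) : ∃ v, ℓ v = i ∧ ℓ (c v) ≠ i := by
  have h : 0 < (Finset.univ.filter fun v => ℓ v = i ∧ ℓ (c v) ≠ i).card := by
    rw [card_improper_eq]
    exact Finset.card_pos.2 ⟨x, by simp [hx, hcx]⟩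
  obtain ⟨v, hv⟩ := Finset.card_pos.1 h
  exact ⟨v, by simpa using hv⟩

variable (T ℓ) in
/-- The number of misplaced tokens outside the fiber of the root. -/
def misplaced (c : Perm V) : ℕ :=
  (Finset.univ.filter fun v => ℓ v ≠ ℓ T.root ∧ ℓ (c v) ≠ ℓ v).card

omit [DecidableEq V] in
lemma card_improper_le (c : Perm V) (i : ι) :
    (Finset.univ.filter fun v => ℓ v = i ∧ ℓ (c v) ≠ i).card ≤ T.misplaced ℓ c := by
  by_cases hi : i = ℓ T.root
  · rw [card_improper_eq]
    refine Finset.card_le_card fun v => ?_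
    simp only [Finset.mem_filter, Finset.mem_univ, true_and]
    rintro ⟨h, h'⟩
    rw [← hi, h']
    exact ⟨h, h.symm⟩
  · refine Finset.card_le_card fun v => ?_
    simp only [Finset.mem_filter, Finset.mem_univ, true_and]
    rintro ⟨h, h'⟩
    rw [h]
    exact ⟨hi, h'⟩

lemma length_le_misplaced {c : Perm V} {i : ι} {L : List V}
    (hL : ∀ w ∈ L, ℓ w = i ∧ ℓ (c w) ≠ i)
    (hd : L.Pairwise (fun x y => T.depth x < T.depth y)) : L.length ≤ T.misplaced ℓ c := by
  have hn : L.Nodup := hd.imp fun {a b} h e => by rw [e] at h; omega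
  rw [← List.toFinset_card_of_nodup hn]
  refine le_trans (Finset.card_le_card fun v hv => ?_) (card_improper_le c i)
  simpa using hL v (by simpa using hv)

omit [DecidableEq V] in
lemma misplaced_le (c : Perm V) :
    T.misplaced ℓ c ≤ (Finset.univ.filter fun v => ℓ v ≠ ℓ T.root).card := by
  refine Finset.card_le_card fun v => ?_
  simp only [Finset.mem_filter, Finset.mem_univ, true_and]
  exact fun h => h.1

variable (T ℓ) in
/-- The misplaced tokens are at the top of the branches at the root. -/
def Heaped (c : Perm V) : Prop :=
  ∀ v, v ≠ T.root → ℓ (c v) ≠ ℓ v → T.parent v = T.root ∨ ℓ (c (T.parent v)) ≠ ℓ (T.parent v)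

omit [Fintype V] [DecidableEq ι] in
lemma Heaped.exists_child (hℓ : T.Respects ℓ) {c : Perm V} (hc : T.Heaped ℓ c) {v : V}
    (hv : v ≠ T.root) (hcv : ℓ (c v) ≠ ℓ v) :
    ∃ w, w ≠ T.root ∧ T.parent w = T.root ∧ ℓ w = ℓ v ∧ ℓ (c w) ≠ ℓ w := by
  induction hk : T.depth v generalizing v with
  | zero => exact absurd (T.depth_pos hv) (by omega)
  | succ k ih =>
    by_cases hp : T.parent v = T.root
    · exact ⟨v, hv, hp, rfl, hcv⟩
    · have := T.depth_parent v hv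
      obtain ⟨w, h₁, h₂, h₃, h₄⟩ := ih hp ((hc v hv hcv).resolve_left hp) (by omega)
      exact ⟨w, h₁, h₂, h₃.trans ((hℓ v hv).resolve_left hp), h₄⟩

/-- Bring the misplaced tokens to the top of the branches, processing vertices from the bottom.
`P` is the set of vertices processed so far. -/
lemma exists_heaped (hℓ : T.Respects ℓ) (P : Finset V) (c : Perm V)
    (hP : ∀ u ∈ P, ∀ v ∉ P, T.depth v ≤ T.depth u)
    (hc : ∀ v, v ≠ T.root → T.parent v ∈ P → T.parent v ≠ T.root → ℓ (c v) ≠ ℓ v →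
      ℓ (c (T.parent v)) ≠ ℓ (T.parent v)) :
    ∃ E : List (ℤ × V), E.Pairwise (T.Follows ℓ) ∧
      (∀ a ∈ E, a.2 ≠ T.root ∧
        a.1 + T.depth a.2 ≤ (Finset.univ.filter fun v => ℓ v ≠ ℓ T.root).card ∧
        ∃ u ∉ P, u ≠ T.root ∧ a.1 = - 2 * T.depth u ∧ T.depth u < T.depth a.2 ∧
          T.ancestor (T.depth u) a.2 = u) ∧
      T.Heaped ℓ (c * (E.map fun a => T.swapUp a.2).prod) := by
  induction hk : Pᶜ.card generalizing P c with
  | zero =>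
    have hP' : ∀ x, x ∈ P := by simpa [Finset.eq_empty_iff_forall_notMem] using hk
    refine ⟨[], by simp, by simp, ?_⟩
    intro v hv hcv
    by_cases hp : T.parent v = T.root
    · exact Or.inl hp
    · right
      simp only [List.map_nil, List.prod_nil, mul_one] at *
      exact hc v hv (hP' _) hp hcv
  | succ k ih =>
    obtain ⟨u, hu, hmax⟩ := Finset.exists_max_image Pᶜ T.depth (Finset.card_pos.1 (by omega))
    simp only [Finset.mem_compl] at hu hmax
    have hcard : (insert u P)ᶜ.card = k := by
      rw [Finset.card_compl] at hk ⊢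
      rw [Finset.card_insert_of_notMem hu]
      omega
    have hP' : ∀ x ∈ insert u P, ∀ v ∉ insert u P, T.depth v ≤ T.depth x := by
      intro x hx v hv
      simp only [Finset.mem_insert, not_or] at hx hv
      rcases hx with rfl | hx
      · exact hmax v hv.2
      · exact hP x hx v hv.2
    by_cases hskip : u = T.root ∨ ℓ (c u) ≠ ℓ u
    · obtain ⟨E, h₁, h₂, h₃⟩ := ih (insert u P) c hP' (by
        intro v hv hp hr hcv
        rcases Finset.mem_insert.1 hp with hp | hp
        · rw [hp]
          exact hskip.resolve_left (hp ▸ hr)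
        · exact hc v hv hp hr hcv) hcard
      refine ⟨E, h₁, ?_, h₃⟩
      intro a ha
      obtain ⟨a₁, a₂, x, hx, a₃⟩ := h₂ a ha
      exact ⟨a₁, a₂, x, fun h => hx (by simp [h]), a₃⟩
    push Not at hskip
    obtain ⟨hur, hcu⟩ := hskip
    obtain ⟨L, d, d₁, d₂, d₃, d₄, d₅, -⟩ := exists_descent (ℓ u) c u hcu
    have hdi : ℓ d = ℓ u ∧ d ≠ T.root := by
      rcases d₅ with h | h
      · rw [h.2]; exact ⟨rfl, hur⟩
      · exact ⟨(d₁ d h.2).2.1, (d₁ d h.2).1⟩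
    have hchild : ∀ v, v ≠ T.root → T.parent v = d → ℓ (c v) = ℓ v := by
      intro v hv hp
      have hvd : ℓ v = ℓ u := by
        rcases hℓ v hv with h | h
        · exact absurd (hp.symm.trans h) hdi.2
        · rw [← h, hp, hdi.1]
      rw [d₄ v hv hp hvd, hvd]
    obtain ⟨E, h₁, h₂, h₃⟩ := ih (insert u P) (c * (L.map T.swapUp).prod) hP' (by
      intro v hv hp hr hcv
      have hdv := T.depth_parent v hv
      have hvu : v ≠ u := by
        rintro rfl
        rcases Finset.mem_insert.1 hp with hp | hp
        · rw [hp] at hdv; omega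
        · have := hP _ hp v hu
          omega
      obtain ⟨hcv, -⟩ := (d₃ v hvu).1 hcv
      have hpd : T.parent v ≠ d := fun h => hcv (hchild v hv h)
      by_cases hpu : T.parent v = u
      · rw [hpu]
        rcases d₅ with h | h
        · exact absurd (hpu.trans h.2.symm) hpd
        · exact h.1
      · refine (d₃ _ hpu).2 ⟨?_, hpd⟩
        exact hc v hv ((Finset.mem_insert.1 hp).resolve_left hpu) hr hcv) hcard
    refine ⟨L.map (fun w => (-2 * (T.depth u : ℤ), w)) ++ E, ?_, ?_, ?_⟩
    · refine List.pairwise_append.2 ⟨List.pairwise_map.2 (d₂.imp fun {x y} h => ?_), h₁, ?_⟩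
      · exact Or.inr (Or.inr (Or.inl ⟨rfl, h⟩))
      · intro a ha b hb
        obtain ⟨w, hw, rfl⟩ := List.mem_map.1 ha
        obtain ⟨-, -, x, hx, b₁, b₂, b₃, b₄⟩ := h₂ b hb
        simp only [Finset.mem_insert, not_or] at hx
        have := hmax x hx.2
        obtain ⟨-, -, -, w₁, -, w₂⟩ := d₁ w hw
        rcases this.lt_or_eq with h | h
        · left
          simp only [b₂]
          omega
        · right; right; right
          rw [h] at b₂ b₃ b₄
          exact ⟨b₂.symm, T.depth u, w₁, b₃, by rw [w₂, b₄]; exact Ne.symm hx.1⟩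
    · intro a ha
      rcases List.mem_append.1 ha with ha | ha
      · obtain ⟨w, hw, rfl⟩ := List.mem_map.1 ha
        obtain ⟨w₁, w₂, w₃, w₄, w₅, w₆⟩ := d₁ w hw
        refine ⟨w₁, ?_, u, hu, hur, rfl, w₄, w₆⟩
        have l₁ := length_le_misplaced (fun w hw => ⟨(d₁ w hw).2.1, (d₁ w hw).2.2.1⟩) d₂
        have l₂ := misplaced_le (T := T) (ℓ := ℓ) c
        simp only
        omega
      · obtain ⟨a₁, a₂, x, hx, a₃⟩ := h₂ a ha
        exact ⟨a₁, a₂, x, fun h => hx (by simp [h]), a₃⟩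
    · simpa [mul_assoc, Function.comp_def] using h₃

/-- Move the token at the root down into the branches of its label. -/
lemma Heaped.exists_descent_root (hℓ : T.Respects ℓ) {c : Perm V} (hc : T.Heaped ℓ c)
    (hx : ∃ x, x ≠ T.root ∧ ℓ x = ℓ (c T.root) ∧ ℓ (c x) ≠ ℓ x) :
    ∃ (L : List V) (d : V),
      (∀ w ∈ L, w ≠ T.root ∧ ℓ w = ℓ (c T.root) ∧ T.depth w ≤ T.misplaced ℓ c) ∧
      L.Pairwise (fun x y => T.depth x < T.depth y) ∧
      T.Heaped ℓ (c * (L.map T.swapUp).prod) ∧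
      ℓ ((c * (L.map T.swapUp).prod) T.root) ≠ ℓ (c T.root) ∧
      ℓ d = ℓ (c T.root) ∧ ℓ (c d) ≠ ℓ d ∧
      ∀ v, v ≠ T.root →
        (ℓ ((c * (L.map T.swapUp).prod) v) ≠ ℓ v ↔ ℓ (c v) ≠ ℓ v ∧ v ≠ d) := by
  obtain ⟨x, hx₀, hxi, hcx⟩ := hx
  obtain ⟨w, hw₀, hwp, hwi, hcw⟩ := hc.exists_child hℓ hx₀ hcx
  obtain ⟨L, d, d₁, d₂, d₃, d₄, d₅, -⟩ := exists_descent (T := T) (ℓ (c T.root)) c T.root rfl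
  have d₅ := d₅.resolve_left (by
    rintro ⟨-, rfl⟩
    exact hcw ((d₄ w hw₀ hwp (hwi.trans hxi)).trans (hwi.trans hxi).symm))
  obtain ⟨hd₀, hdi, hcd, -⟩ := d₁ d d₅.2
  refine ⟨L, d, ?_, d₂, ?_, d₅.1, hdi, by rwa [hdi], d₃⟩
  · intro y hy
    obtain ⟨y₁, y₂, y₃, y₄, y₅, y₆⟩ := d₁ y hy
    have := length_le_misplaced (fun w hw => ⟨(d₁ w hw).2.1, (d₁ w hw).2.2.1⟩) d₂
    rw [T.depth_root] at y₅
    exact ⟨y₁, y₂, by omega⟩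
  · intro v hv hcv
    obtain ⟨hcv, -⟩ := (d₃ v hv).1 hcv
    by_cases hp : T.parent v = T.root
    · exact Or.inl hp
    · right
      refine (d₃ _ hp).2 ⟨(hc v hv hcv).resolve_left hp, fun h => ?_⟩
      have hvi : ℓ v = ℓ (c T.root) := by rw [← (hℓ v hv).resolve_left hp, h, hdi]
      exact hcv ((d₄ v hv h hvi).trans hvi.symm)

/-- Bring a token to the root that does not belong to the fiber of the root. -/
lemma Heaped.exists_fetch (hℓ : T.Respects ℓ) {c : Perm V} (hc : T.Heaped ℓ c)
    (hb : 0 < T.misplaced ℓ c) {i₀ : ι} (hi₀ : i₀ ≠ ℓ T.root) :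
    ∃ L : List V,
      (∀ w ∈ L, w ≠ T.root ∧ ℓ w ≠ i₀ ∧ T.depth w ≤ T.misplaced ℓ c ∧
        ℓ w ≠ ℓ ((c * (L.map T.swapUp).prod) T.root)) ∧
      L.Pairwise (fun x y => T.depth x < T.depth y) ∧
      T.Heaped ℓ (c * (L.map T.swapUp).prod) ∧
      ℓ ((c * (L.map T.swapUp).prod) T.root) ≠ ℓ T.root ∧
      T.misplaced ℓ (c * (L.map T.swapUp).prod) = T.misplaced ℓ c := by
  by_cases hr : ℓ (c T.root) = ℓ T.root
  swap
  · exact ⟨[], by simp, by simp, by simpa using hc, by simpa using hr, by simp⟩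
  by_cases hx : ∃ x, ℓ x = ℓ T.root ∧ ℓ (c x) ≠ ℓ x
  · obtain ⟨x, hxi, hcx⟩ := hx
    obtain ⟨L, d, d₁, d₂, d₃, d₄, d₅, d₆, d₇⟩ := hc.exists_descent_root hℓ
      ⟨x, by rintro rfl; exact hcx hr, by rw [hxi, hr], hcx⟩
    rw [hr] at *
    refine ⟨L, ?_, d₂, d₃, d₄, ?_⟩
    · intro w hw
      obtain ⟨w₁, w₂, w₃⟩ := d₁ w hw
      refine ⟨w₁, by rw [w₂]; exact hi₀.symm, w₃, by rw [w₂]; exact d₄.symm⟩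
    · rw [misplaced, misplaced]
      congr 1
      ext v
      simp only [Finset.mem_filter, Finset.mem_univ, true_and]
      by_cases hv : ℓ v = ℓ T.root
      · simp [hv]
      · rw [d₇ v (by rintro rfl; exact hv rfl)]
        have : v ≠ d := by rintro rfl; exact hv d₅
        simp [this]
  · push Not at hx
    obtain ⟨v, hv⟩ := Finset.card_pos.1 hb
    simp only [Finset.mem_filter, Finset.mem_univ, true_and] at hv
    have hroot : ∀ y, ℓ y ≠ ℓ T.root → ℓ (c y) ≠ ℓ T.root := by
      intro y hy h
      obtain ⟨z, hz, hcz⟩ := exists_improper_of_misplaced c hy h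
      exact hcz ((hx z hz).trans hz)
    have hex : ∃ y, ℓ y ≠ ℓ T.root ∧ ℓ y ≠ i₀ ∧ ℓ (c y) ≠ ℓ y := by
      by_cases hvi : ℓ v = i₀
      · obtain ⟨z, hz, hcz⟩ := exists_improper_of_misplaced c hv.2.symm rfl
        refine ⟨z, ?_, ?_, by rwa [hz]⟩
        · rw [hz]; exact hroot v hv.1
        · rw [hz, ← hvi]; exact hv.2
      · exact ⟨v, hv.1, hvi, hv.2⟩
    obtain ⟨y, hy₁, hy₂, hy₃⟩ := hex
    obtain ⟨w, w₁, w₂, w₃, w₄⟩ := hc.exists_child hℓ (by rintro rfl; exact hy₁ rfl) hy₃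
    have hw : ℓ w ≠ ℓ T.root := by rwa [w₃]
    have e₁ : (c * T.swapUp w) w = c T.root := by simp [swapUp, w₂]
    have e₂ : (c * T.swapUp w) T.root = c w := by simp [swapUp, w₂]
    have himp : ∀ v, v ≠ T.root → (ℓ ((c * T.swapUp w) v) ≠ ℓ v ↔ ℓ (c v) ≠ ℓ v) := by
      intro v hv
      by_cases hvw : v = w
      · rw [hvw, e₁, hr]
        exact ⟨fun _ => w₄, fun _ => hw.symm⟩
      · simp [swapUp, w₂, swap_apply_of_ne_of_ne hv hvw]
    refine ⟨[w], ?_, by simp, ?_, ?_, ?_⟩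
    · simp only [List.mem_singleton, List.map_cons, List.map_nil, List.prod_singleton, forall_eq,
        e₂]
      refine ⟨w₁, by rwa [w₃], ?_, w₄.symm⟩
      have := T.depth_parent w w₁
      rw [w₂, T.depth_root] at this
      omega
    · simp only [List.map_cons, List.map_nil, List.prod_singleton]
      intro v hv hcv
      by_cases hp : T.parent v = T.root
      · exact Or.inl hp
      · right
        exact (himp _ hp).2 ((hc v hv ((himp v hv).1 hcv)).resolve_left hp)
    · simp only [List.map_cons, List.map_nil, List.prod_singleton, e₂]
      exact hroot w hw
    · simp only [List.map_cons, List.map_nil, List.prod_singleton, misplaced]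
      congr 1
      ext v
      simp only [Finset.mem_filter, Finset.mem_univ, true_and]
      by_cases hv : ℓ v = ℓ T.root
      · simp [hv]
      · rw [himp v (by rintro rfl; exact hv rfl)]

/-- Exchange tokens through the root until all tokens have reached the fiber of their label. -/
lemma Heaped.exists_exchange (hℓ : T.Respects ℓ) {c : Perm V} (hc : T.Heaped ℓ c) {i₀ : ι}
    (hi₀ : i₀ ≠ ℓ T.root) (τ : ℤ) :
    ∃ E : List (ℤ × V), E.Pairwise (T.Follows ℓ) ∧
      (∀ a ∈ E, a.2 ≠ T.root ∧ τ ≤ a.1 ∧ (a.1 = τ → ℓ a.2 ≠ i₀) ∧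
        a.1 + T.depth a.2 ≤ τ + 2 * T.misplaced ℓ c) ∧
      ∀ v, ℓ ((c * (E.map fun a => T.swapUp a.2).prod) v) = ℓ v := by
  induction hb : T.misplaced ℓ c generalizing c i₀ τ with
  | zero =>
    refine ⟨[], by simp, by simp, fun v => ?_⟩
    by_contra h
    have h' := card_improper_le (T := T) (ℓ := ℓ) c (ℓ v)
    rw [hb, Nat.le_zero, Finset.card_eq_zero, Finset.filter_eq_empty_iff] at h'
    exact h' (Finset.mem_univ v) ⟨rfl, by simpa using h⟩
  | succ b ih =>
    obtain ⟨L, l₁, l₂, l₃, l₄, l₅⟩ := hc.exists_fetch hℓ (by omega) hi₀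
    set c₁ := c * (L.map T.swapUp).prod with hc₁
    obtain ⟨x, hxi, hcx⟩ := exists_improper_of_misplaced c₁ l₄.symm rfl
    obtain ⟨M, d, m₁, m₂, m₃, -, m₅, m₆, m₇⟩ := l₃.exists_descent_root hℓ
      ⟨x, by rintro rfl; exact l₄ hxi.symm, hxi, by rwa [hxi]⟩
    set c₂ := c₁ * (M.map T.swapUp).prod with hc₂
    have hm : T.misplaced ℓ c₂ = b := by
      have : T.misplaced ℓ c₂ + 1 = T.misplaced ℓ c₁ := by
        have hd : d ∈ Finset.univ.filter fun v => ℓ v ≠ ℓ T.root ∧ ℓ (c₁ v) ≠ ℓ v := by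
          simp only [Finset.mem_filter, Finset.mem_univ, true_and]
          exact ⟨by rwa [m₅], m₆⟩
        rw [misplaced, misplaced, ← Finset.card_erase_add_one hd]
        congr 2
        ext v
        simp only [Finset.mem_filter, Finset.mem_univ, true_and, Finset.mem_erase]
        by_cases hv : ℓ v = ℓ T.root
        · simp [hv]
        · rw [m₇ v (by rintro rfl; exact hv rfl)]
          tauto
      omega
    obtain ⟨E, e₁, e₂, e₃⟩ := ih m₃ l₄ (τ + 2) hm
    refine ⟨L.map (fun w => (τ, w)) ++ (M.map (fun w => (τ + 1, w)) ++ E), ?_, ?_, ?_⟩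
    · refine List.pairwise_append.2 ⟨List.pairwise_map.2 (l₂.imp fun {x y} h => ?_),
        List.pairwise_append.2 ⟨List.pairwise_map.2 (m₂.imp fun {x y} h => ?_), e₁, ?_⟩, ?_⟩
      · exact Or.inr (Or.inr (Or.inl ⟨rfl, h⟩))
      · exact Or.inr (Or.inr (Or.inl ⟨rfl, h⟩))
      · intro a ha a' ha'
        obtain ⟨w, hw, rfl⟩ := List.mem_map.1 ha
        obtain ⟨-, h₁, h₂, -⟩ := e₂ a' ha'
        by_cases h : a'.1 = τ + 2
        · right; left
          refine ⟨by simp [h], ?_⟩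
          rw [(m₁ w hw).2.1]
          exact (h₂ h).symm
        · left
          simp only
          omega
      · intro a ha a' ha'
        obtain ⟨w, hw, rfl⟩ := List.mem_map.1 ha
        rcases List.mem_append.1 ha' with ha' | ha'
        · obtain ⟨w', hw', rfl⟩ := List.mem_map.1 ha'
          right; left
          refine ⟨by simp, ?_⟩
          simp only
          rw [(m₁ w' hw').2.1]
          exact (l₁ w hw).2.2.2
        · exact Or.inl (e₂ a' ha').2.1
    · intro a ha
      rcases List.mem_append.1 ha with ha | ha
      · obtain ⟨w, hw, rfl⟩ := List.mem_map.1 ha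
        obtain ⟨w₁, w₂, w₃, -⟩ := l₁ w hw
        refine ⟨w₁, le_rfl, fun _ => w₂, ?_⟩
        simp only
        omega
      rcases List.mem_append.1 ha with ha | ha
      · obtain ⟨w, hw, rfl⟩ := List.mem_map.1 ha
        obtain ⟨w₁, w₂, w₃⟩ := m₁ w hw
        refine ⟨w₁, by simp, by simp, ?_⟩
        simp only
        omega
      · obtain ⟨a₁, a₂, a₃, a₄⟩ := e₂ a ha
        refine ⟨a₁, by omega, by omega, ?_⟩
        push_cast
        omega
    · simpa [hc₂, hc₁, mul_assoc, Function.comp_def] using e₃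

/-- Every permutation can be turned into a label preserving one within
`2 * m + D - 1` rounds, where `m` is the number of vertices outside the fiber of the root and `D`
bounds the depth of the tree. -/
lemma exists_rounds_label_preserving {G : SimpleGraph V} (hℓ : T.Respects ℓ)
    (hG : ∀ x, x ≠ T.root → G.Adj (T.parent x) x) (c : Perm V) (D : ℕ) (hD₀ : 0 < D)
    (hD : ∀ x, T.depth x ≤ D) :
    ∃ L : List (Perm V),
      L.length = 2 * (Finset.univ.filter fun v => ℓ v ≠ ℓ T.root).card + D - 1 ∧
      (∀ σ ∈ L, IsRound G σ) ∧ ∀ v, ℓ ((c * L.prod) v) = ℓ v := by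
  set m := (Finset.univ.filter fun v => ℓ v ≠ ℓ T.root).card with hm
  obtain ⟨E, e₁, e₂, e₃⟩ : ∃ E : List (ℤ × V), E.Pairwise (T.Follows ℓ) ∧
      (∀ a ∈ E, a.2 ≠ T.root ∧ 2 - (D : ℤ) ≤ a.1 + T.depth a.2 ∧
        a.1 + T.depth a.2 ≤ 2 * m) ∧
      ∀ v, ℓ ((c * (E.map fun a => T.swapUp a.2).prod) v) = ℓ v := by
    by_cases hi : ∃ x, ℓ x ≠ ℓ T.root
    · obtain ⟨x, hx⟩ := hi
      obtain ⟨E, e₁, e₂, e₃⟩ := exists_heaped hℓ ∅ c (by simp) (by simp)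
      obtain ⟨F, f₁, f₂, f₃⟩ := e₃.exists_exchange hℓ hx 0
      refine ⟨E ++ F, ?_, ?_, by simpa [mul_assoc] using f₃⟩
      · refine List.pairwise_append.2 ⟨e₁, f₁, fun a ha b hb => ?_⟩
        obtain ⟨-, -, u, -, hu, ha, -⟩ := e₂ a ha
        have := T.depth_pos hu
        have := (f₂ b hb).2.1
        left
        omega
      · intro a ha
        rcases List.mem_append.1 ha with ha | ha
        · obtain ⟨a₁, a₂, u, -, -, a₃, a₄, -⟩ := e₂ a ha
          have := hD a.2
          exact ⟨a₁, by omega, by omega⟩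
        · obtain ⟨a₁, a₂, -, a₃⟩ := f₂ a ha
          have := T.depth_pos a₁
          have := misplaced_le (T := T) (ℓ := ℓ) (c * (E.map fun a => T.swapUp a.2).prod)
          exact ⟨a₁, by omega, by omega⟩
    · push Not at hi
      exact ⟨[], by simp, by simp, by simp [hi]⟩
  obtain ⟨L, l₁, l₂, l₃⟩ := exists_rounds_of_schedule (G := G)
    (fun a : ℤ × V => a.1 + T.depth a.2) (fun a => T.swapUp a.2) (2 * m + D - 1) E (2 - D)
    (fun a ha => IsRound.swap (hG _ (e₂ a ha).1))
    (e₁.imp_of_mem fun {a b} ha hb h => h.lt_or_disjoint hℓ (e₂ a ha).1 (e₂ b hb).1)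
    (fun a ha => ⟨(e₂ a ha).2.1, by have := (e₂ a ha).2.2; omega⟩)
  exact ⟨L, l₁, l₂, by rwa [l₃]⟩

end ParentTree

section Fibers

variable {V ι : Type*} {G : SimpleGraph V}

/-- Routings inside the fibers of a labelling can be executed in parallel. -/
lemma exists_rounds_of_fibers (ℓ : V → ι) (N : ℕ) {ρ : Perm V} (hρ : ∀ v, ℓ (ρ v) = ℓ v)
    (h : ∀ i, ∀ σ : Perm {v // ℓ v = i}, ∃ L : List (Perm {v // ℓ v = i}),
      L.length ≤ N ∧ (∀ τ ∈ L, IsRound (G.comap Subtype.val) τ) ∧ L.prod = σ) :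
    ∃ L : List (Perm V), L.length = N ∧ (∀ τ ∈ L, IsRound G τ) ∧ L.prod = ρ := by
  let Φ : (∀ i, Perm {v // ℓ v = i}) →* Perm V :=
    (sigmaFiberEquiv ℓ).permCongrHom.toMonoidHom.comp (Perm.sigmaCongrRightHom _)
  have hΦ : ∀ s v, Φ s v = s (ℓ v) ⟨v, rfl⟩ := fun _ _ => rfl
  have hΦ' : ∀ s i (v : {v // ℓ v = i}), Φ s v = s i v := by
    rintro s _ ⟨v, rfl⟩
    rfl
  obtain ⟨s, hs⟩ : ∃ s, Φ s = ρ := by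
    refine ⟨fun i => ρ.subtypePerm fun v => by rw [hρ], Equiv.ext fun v => ?_⟩
    rw [hΦ]
    rfl
  choose L hL hR hp using fun i => h i (s i)
  refine ⟨(List.range N).map fun k => Φ fun i => (L i).getD k 1, by simp, ?_, ?_⟩
  · intro τ hτ
    obtain ⟨k, -, rfl⟩ := List.mem_map.1 hτ
    intro v
    have hr : IsRound (G.comap Subtype.val) ((L (ℓ v)).getD k 1) := by
      by_cases hk : k < (L (ℓ v)).length
      · rw [List.getD_eq_getElem _ _ hk]
        exact hR _ _ (List.getElem_mem hk)
      · rw [List.getD_eq_default _ _ (by omega)]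
        exact IsRound.one
    rw [hΦ, hΦ']
    rcases hr ⟨v, rfl⟩ with h | ⟨h₁, h₂⟩
    · exact Or.inl (congrArg Subtype.val h)
    · exact Or.inr ⟨h₁, congrArg Subtype.val h₂⟩
  · have key : ∀ i, ((List.range N).map fun k => (L i).getD k 1).prod = s i := by
      intro i
      rw [← hp i]
      have : (List.range N).map (fun k => (L i).getD k 1) =
          L i ++ List.replicate (N - (L i).length) 1 := by
        refine List.ext_getElem (by simp [hL i]) fun k h₁ h₂ => ?_
        simp only [List.getElem_map, List.getElem_range, List.getElem_append,
          List.getElem_replicate]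
        split_ifs with hk
        · exact List.getD_eq_getElem _ _ hk
        · exact List.getD_eq_default _ _ (by omega)
      rw [this]
      simp
    rw [← hs, show (fun k => Φ fun i => (L i).getD k 1) = Φ ∘ fun k i => (L i).getD k 1 from rfl,
      ← List.map_map, ← map_list_prod]
    congr 1
    ext1 i
    rw [← key i]
    exact (map_list_prod (Pi.evalMonoidHom (fun i => Perm {v // ℓ v = i}) i) _).trans
      (by rw [List.map_map]; rfl)

end Fibers

section Partition

variable {V : Type*} {G : SimpleGraph V}

lemma SimpleGraph.Connected.exists_parentTree (hG : G.Connected) (z : V) :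
    ∃ T : ParentTree V, T.root = z ∧ ∀ x, x ≠ T.root → G.Adj (T.parent x) x := by
  have h : ∀ x, ∃ y, x ≠ z → G.Adj y x ∧ G.dist z y + 1 = G.dist z x := by
    intro x
    by_cases hx : x = z
    · exact ⟨x, fun h => absurd hx h⟩
    · obtain ⟨p, hp⟩ := hG.exists_walk_length_eq_dist x z
      cases p with
      | nil => exact absurd rfl hx
      | @cons _ y _ hxy q =>
        refine ⟨y, fun _ => ⟨hxy.symm, ?_⟩⟩
        have h₁ := SimpleGraph.dist_le q
        have h₂ := hG.dist_triangle (u := x) (v := y) (w := z)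
        rw [SimpleGraph.dist_eq_one_iff_adj.2 hxy] at h₂
        rw [SimpleGraph.Walk.length_cons] at hp
        rw [SimpleGraph.dist_comm (u := z), SimpleGraph.dist_comm (u := z)]
        omega
  choose f hf using h
  exact ⟨⟨z, f, G.dist z, by simp, fun x hx => (hf x hx).2⟩, rfl, fun x hx => (hf x hx).1⟩

namespace ParentTree

variable (T : ParentTree V)

lemma ancestor_depth_parent_eq_iff {v x : V} (hx : x ≠ T.root) (hxv : x ≠ v) :
    T.ancestor (T.depth v) (T.parent x) = v ↔ T.ancestor (T.depth v) x = v := by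
  have := T.depth_parent x hx
  by_cases h : T.depth v < T.depth x
  · rw [T.ancestor_parent h]
  · rw [T.ancestor_of_le (by omega), T.ancestor_of_le (by omega)]
    refine ⟨fun h' => ?_, fun h' => absurd h' hxv⟩
    rw [h'] at this
    omega

lemma depth_lt_of_ancestor {v x : V} (h : T.ancestor (T.depth v) x = v) (hxv : x ≠ v) :
    T.depth v < T.depth x := by
  by_contra h'
  exact hxv (by rwa [T.ancestor_of_le (by omega)] at h)

lemma preconnected_induce (hG : ∀ x, x ≠ T.root → G.Adj (T.parent x) x) (t : V) (S : Set V)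
    (hS : ∀ x ∈ S, x = t ∨ (x ≠ T.root ∧ T.parent x ∈ S)) : (G.induce S).Preconnected := by
  have key : ∀ x (hx : x ∈ S), ∃ ht : t ∈ S, (G.induce S).Reachable ⟨x, hx⟩ ⟨t, ht⟩ := by
    intro x
    induction hk : T.depth x generalizing x with
    | zero =>
      intro hx
      rcases hS x hx with rfl | h
      · exact ⟨hx, SimpleGraph.Reachable.rfl⟩
      · exact absurd (T.depth_pos h.1) (by omega)
    | succ k ih =>
      intro hx
      rcases hS x hx with rfl | ⟨h₁, h₂⟩
      · exact ⟨hx, SimpleGraph.Reachable.rfl⟩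
      · obtain ⟨ht, h⟩ := ih (T.parent x) (by have := T.depth_parent x h₁; omega) h₂
        refine ⟨ht, SimpleGraph.Reachable.trans (SimpleGraph.Adj.reachable ?_) h⟩
        exact (hG x h₁).symm
  rintro ⟨x, hx⟩ ⟨y, hy⟩
  obtain ⟨_, h₁⟩ := key x hx
  obtain ⟨_, h₂⟩ := key y hy
  exact h₁.trans h₂.symm

lemma depth_le_card_fiber {ι : Type*} [Fintype V] [DecidableEq ι] {ℓ : V → ι}
    (hℓ : T.Respects ℓ) (x : V) :
    T.depth x ≤ (Finset.univ.filter fun y => ℓ y = ℓ x).card := by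
  have hlab : ∀ k, k < T.depth x → ℓ (T.ancestor (T.depth x - k) x) = ℓ x := by
    intro k hk
    induction k with
    | zero => rw [T.ancestor_of_le (by omega)]
    | succ k ih =>
      rw [← T.parent_ancestor (by omega), ← ih (by omega),
        show T.depth x - (k + 1) + 1 = T.depth x - k by omega]
      have hd := T.depth_ancestor (show T.depth x - k ≤ T.depth x by omega)
      have hne := T.ne_root_of_depth_pos (x := T.ancestor (T.depth x - k) x) (by omega)
      refine (hℓ _ hne).resolve_left fun h => ?_
      have := T.depth_parent _ hne
      rw [h, T.depth_root] at this
      omega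
  have h := Finset.card_le_card_of_injOn (s := Finset.Icc 1 (T.depth x))
    (t := Finset.univ.filter fun y => ℓ y = ℓ x) (fun e => T.ancestor e x) (fun e he => by
      simp only [Finset.coe_Icc, Set.mem_Icc] at he
      have := hlab (T.depth x - e) (by omega)
      rw [show T.depth x - (T.depth x - e) = e by omega] at this
      simpa using this) (fun e he e' he' h => by
      simp only [Finset.coe_Icc, Set.mem_Icc] at he he'
      have := congrArg T.depth h
      rwa [T.depth_ancestor he.2, T.depth_ancestor he'.2] at this)
  simpa using h

end ParentTree

/-- The vertices of a connected graph can be partitioned into connected parts around a vertex `z`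
such that the part of `z` is the largest one and contains about half of the vertices at most. -/
lemma SimpleGraph.Connected.exists_partition [Fintype V] [DecidableEq V] (hG : G.Connected)
    (hn : 2 ≤ Fintype.card V) :
    ∃ (z : V) (ℓ : V → V), (∀ i, (G.induce {y | ℓ y = i}).Preconnected) ∧
      (∀ x, ℓ x ≠ ℓ z → ∃ r, ℓ r = ℓ x ∧ G.Adj z r) ∧
      (∀ i, (Finset.univ.filter fun x => ℓ x = i).card ≤
        (Finset.univ.filter fun x => ℓ x = ℓ z).card) ∧
      2 * (Finset.univ.filter fun x => ℓ x = ℓ z).card ≤ Fintype.card V + 1 := by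
  obtain ⟨ρ⟩ := hG.nonempty
  obtain ⟨T, hρ, hT⟩ := hG.exists_parentTree ρ
  let s : V → ℕ := fun v => (Finset.univ.filter fun x => T.ancestor (T.depth v) x = v).card
  have hcompl : ∀ v, s v + (Finset.univ.filter fun x => T.ancestor (T.depth v) x ≠ v).card =
      Fintype.card V := fun v => Finset.card_filter_add_card_filter_not _
  have hs_root : s ρ = Fintype.card V := by
    have : ∀ x, T.ancestor (T.depth ρ) x = ρ := fun x => by
      rw [← hρ, T.depth_root, T.ancestor_zero]
    simp [s, this]
  obtain ⟨v, hv, hmin⟩ := Finset.exists_min_image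
    (Finset.univ.filter fun v => Fintype.card V ≤ 2 * s v) s
    ⟨ρ, by simp only [Finset.mem_filter, Finset.mem_univ, true_and]; omega⟩
  simp only [Finset.mem_filter, Finset.mem_univ, true_and] at hv hmin
  have hparent : v ≠ ρ → T.ancestor (T.depth v) (T.parent v) ≠ v ∧ T.parent v ≠ v := by
    intro hvρ
    have := T.depth_parent v (by rwa [hρ])
    have h : T.parent v ≠ v := fun h => by rw [h] at this; omega
    rw [T.ancestor_of_le (by omega)]
    exact ⟨h, h⟩
  have hρ_sub : v ≠ ρ → T.ancestor (T.depth v) ρ ≠ v := by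
    intro hvρ
    rw [T.ancestor_of_le (by rw [← hρ, T.depth_root]; omega)]
    exact hvρ.symm
  by_cases hv' : 2 * s v ≤ Fintype.card V + 1
  · have hvρ : v ≠ ρ := by rintro rfl; omega
    let ℓ : V → V := fun x => if T.ancestor (T.depth v) x = v then v else ρ
    have hv₁ : ∀ x, ℓ x = v ↔ T.ancestor (T.depth v) x = v := by
      intro x
      simp only [ℓ]
      split_ifs with h <;> simp [h, hvρ.symm]
    have hρ₁ : ∀ x, ℓ x = ρ ↔ T.ancestor (T.depth v) x ≠ v := by
      intro x
      simp only [ℓ]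
      split_ifs with h <;> simp [h, hvρ]
    have hvv : ℓ v = v := (hv₁ v).2 (T.ancestor_of_le le_rfl)
    have hor : ∀ x, ℓ x = v ∨ ℓ x = ρ := fun x => by simp only [ℓ]; split_ifs <;> simp
    have hcard : (Finset.univ.filter fun x => ℓ x = v).card = s v := by simp only [hv₁, s]
    refine ⟨v, ℓ, ?_, ?_, ?_, by rwa [hvv, hcard]⟩
    · intro i
      refine T.preconnected_induce hT i _ fun x hx => or_iff_not_imp_left.2 fun hxi => ?_
      rw [Set.mem_ofPred_eq] at hx
      rcases hor x with h | h
      · obtain rfl : v = i := h.symm.trans hx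
        have hlt := T.depth_lt_of_ancestor ((hv₁ x).1 h) hxi
        have hne := T.ne_root_of_depth_pos (x := x) (by omega)
        exact ⟨hne, (hv₁ _).2 ((T.ancestor_depth_parent_eq_iff hne hxi).2 ((hv₁ x).1 h))⟩
      · obtain rfl : ρ = i := h.symm.trans hx
        have hne : x ≠ T.root := by rwa [hρ]
        have h' := (hρ₁ x).1 h
        have hxv : x ≠ v := by rintro rfl; exact h' (T.ancestor_of_le le_rfl)
        exact ⟨hne, (hρ₁ _).2 fun h'' => h' ((T.ancestor_depth_parent_eq_iff hne hxv).1 h'')⟩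
    · intro x hx
      rw [hvv] at hx
      refine ⟨T.parent v, ?_, (hT v (by rwa [hρ])).symm⟩
      rw [(hor x).resolve_left hx, hρ₁]
      exact (hparent hvρ).1
    · intro i
      rw [hvv, hcard]
      by_cases hi : i = v
      · rw [hi, hcard]
      · refine le_trans (Finset.card_le_card (t := Finset.univ.filter fun x =>
          T.ancestor (T.depth v) x ≠ v) fun x hx => ?_) (by have := hcompl v; omega)
        simp only [Finset.mem_filter, Finset.mem_univ, true_and] at hx ⊢
        rintro h
        exact hi (hx.symm.trans ((hv₁ x).2 h))
  · let ℓ₀ : V → V := fun x =>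
      if T.ancestor (T.depth v) x = v then T.ancestor (T.depth v + 1) x else ρ
    have hdepth : ∀ x, x ≠ v → T.ancestor (T.depth v) x = v →
        T.depth (ℓ₀ x) = T.depth v + 1 ∧ T.parent (ℓ₀ x) = v ∧ ℓ₀ (ℓ₀ x) = ℓ₀ x ∧
        T.ancestor (T.depth (ℓ₀ x)) x = ℓ₀ x ∧ ℓ₀ x ≠ v := by
      intro x hx h
      have hlt := T.depth_lt_of_ancestor h hx
      have e : ℓ₀ x = T.ancestor (T.depth v + 1) x := if_pos h
      have hd : T.depth (ℓ₀ x) = T.depth v + 1 := by rw [e, T.depth_ancestor (by omega)]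
      have hp : T.parent (ℓ₀ x) = v := by rw [e, T.parent_ancestor hlt, h]
      refine ⟨hd, hp, ?_, by rw [hd, e], fun h' => by rw [h'] at hd; omega⟩
      have : T.ancestor (T.depth v) (ℓ₀ x) = v := by
        rw [← T.ancestor_parent (by omega), hp, T.ancestor_of_le le_rfl]
      rw [show ℓ₀ (ℓ₀ x) = _ from if_pos this, T.ancestor_of_le (by omega)]
    have hout : ∀ x, T.ancestor (T.depth v) x ≠ v → ℓ₀ x = ρ := fun x h => if_neg h
    have hroot : ∀ x, x ≠ v → (ℓ₀ x = ρ ↔ T.ancestor (T.depth v) x ≠ v) := by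
      refine fun x hx => ⟨fun h h' => ?_, hout x⟩
      have := (hdepth x hx h').1
      rw [h, ← hρ, T.depth_root] at this
      omega
    let N : V → ℕ := fun i => (Finset.univ.filter fun x => x ≠ v ∧ ℓ₀ x = i).card
    obtain ⟨m, -, hm⟩ := Finset.exists_max_image Finset.univ N ⟨v, Finset.mem_univ v⟩
    replace hm := fun i => hm i (Finset.mem_univ i)
    obtain ⟨y, hy⟩ := Fintype.exists_ne_of_one_lt_card hn v
    have hmpos : 0 < N m := lt_of_lt_of_le (Finset.card_pos.2 ⟨y, by simp [hy]⟩) (hm (ℓ₀ y))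
    obtain ⟨y, hy⟩ := Finset.card_pos.1 hmpos
    simp only [Finset.mem_filter, Finset.mem_univ, true_and] at hy
    obtain ⟨hyv, hym⟩ := hy
    have hroot' : v = ρ → ∀ x, T.ancestor (T.depth v) x = v := by
      rintro rfl x
      rw [← hρ, T.depth_root, T.ancestor_zero]
    have hNm : 2 * (N m + 1) ≤ Fintype.card V + 1 := by
      by_cases hmρ : m = ρ
      · have : N m ≤ (Finset.univ.filter fun x => T.ancestor (T.depth v) x ≠ v).card := by
          refine Finset.card_le_card fun x => ?_
          simp only [Finset.mem_filter, Finset.mem_univ, true_and]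
          rintro ⟨h₁, h₂⟩
          exact (hroot x h₁).1 (h₂.trans hmρ)
        have := hcompl v
        omega
      · have hy' : T.ancestor (T.depth v) y = v := by
          by_contra h
          exact hmρ (hym.symm.trans (hout y h))
        obtain ⟨h₁, h₂, -, h₄, h₅⟩ := hdepth y hyv hy'
        rw [hym] at *
        have hle : N m ≤ s m := by
          refine Finset.card_le_card fun x => ?_
          simp only [Finset.mem_filter, Finset.mem_univ, true_and]
          rintro ⟨hx, hxm⟩
          have hx' : T.ancestor (T.depth v) x = v := by
            by_contra h
            exact hmρ (hxm.symm.trans (hout x h))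
          have := (hdepth x hx hx').2.2.2.1
          rwa [hxm] at this
        have hlt : s m < s v := by
          refine Finset.card_lt_card ⟨fun x => ?_, fun h => ?_⟩
          · simp only [Finset.mem_filter, Finset.mem_univ, true_and]
            intro hx
            have hdx : T.depth v + 1 ≤ T.depth x := by
              by_contra h
              rw [T.ancestor_of_le (by omega)] at hx
              rw [hx] at h
              omega
            rw [h₁] at hx
            rw [← T.parent_ancestor (by omega), hx, h₂]
          · have := h (show v ∈ _ by simp [T.ancestor_of_le])
            simp only [Finset.mem_filter, Finset.mem_univ, true_and] at this
            rw [T.ancestor_of_le (by omega)] at this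
            exact h₅ this.symm
        have : ¬ Fintype.card V ≤ 2 * s m := fun h => by
          have := hmin m h
          omega
        omega
    let ℓ : V → V := fun x => if x = v then m else ℓ₀ x
    have hℓv : ℓ v = m := if_pos rfl
    have hℓ : ∀ x, x ≠ v → ℓ x = ℓ₀ x := fun x h => if_neg h
    have hcard : (Finset.univ.filter fun x => ℓ x = m).card = N m + 1 := by
      rw [← Finset.card_erase_add_one (a := v) (by simp [hℓv])]
      congr 2
      ext x
      simp only [Finset.mem_erase, Finset.mem_filter, Finset.mem_univ, true_and]
      exact and_congr_right fun h => by rw [hℓ x h]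
    refine ⟨v, ℓ, ?_, ?_, ?_, by rwa [hℓv, hcard]⟩
    · intro i
      by_cases hiρ : i = ρ
      · refine T.preconnected_induce hT ρ _ fun x hx => or_iff_not_imp_left.2 fun hxi => ?_
        rw [Set.mem_ofPred_eq, hiρ] at hx ⊢
        have hne : x ≠ T.root := by rwa [hρ]
        refine ⟨hne, ?_⟩
        by_cases hxv : x = v
        · rw [hxv]
          rw [hxv] at hxi
          rw [hℓ _ (hparent hxi).2]
          exact hout _ (hparent hxi).1
        · rw [hℓ x hxv, hroot x hxv] at hx
          have h := mt (T.ancestor_depth_parent_eq_iff hne hxv).1 hx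
          rw [hℓ _ (by intro h'; rw [h'] at h; exact h (T.ancestor_of_le le_rfl))]
          exact hout _ h
      · refine T.preconnected_induce hT (if i = m then v else i) _
          fun x hx => or_iff_not_imp_left.2 fun hxi => ?_
        rw [Set.mem_ofPred_eq] at hx ⊢
        have hxv : x ≠ v := by
          rintro rfl
          rw [hℓv] at hx
          simp [hx] at hxi
        rw [hℓ x hxv] at hx
        have hx' : T.ancestor (T.depth v) x = v := by
          by_contra h
          exact hiρ (hx.symm.trans (hout x h))
        have hlt := T.depth_lt_of_ancestor hx' hxv
        have hne := T.ne_root_of_depth_pos (x := x) (by omega)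
        refine ⟨hne, ?_⟩
        obtain ⟨h₁, h₂, -, h₄, -⟩ := hdepth x hxv hx'
        rw [hx] at h₁ h₂ h₄
        by_cases hp : T.parent x = v
        · have : x = i := by
            have := T.depth_parent x hne
            rw [hp] at this
            rwa [T.ancestor_of_le (by omega)] at h₄
          rw [hp, hℓv]
          by_contra h
          exact hxi (by rw [if_neg (fun h' => h h'.symm), this])
        · have hpv := (T.ancestor_depth_parent_eq_iff hne hxv).2 hx'
          have := T.depth_parent x hne
          have := T.depth_lt_of_ancestor hpv hp
          rw [hℓ _ hp, ← hx, show ℓ₀ (T.parent x) = _ from if_pos hpv,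
            show ℓ₀ x = _ from if_pos hx', T.ancestor_parent (by omega)]
    · intro x hx
      have hxv : x ≠ v := by rintro rfl; exact hx rfl
      by_cases hx' : T.ancestor (T.depth v) x = v
      · obtain ⟨h₁, h₂, h₃, -, h₅⟩ := hdepth x hxv hx'
        refine ⟨ℓ₀ x, by rw [hℓ _ h₅, hℓ _ hxv, h₃], ?_⟩
        have := hT (ℓ₀ x) (T.ne_root_of_depth_pos (by omega))
        rwa [h₂] at this
      · have hvρ : v ≠ ρ := fun h => hx' (hroot' h x)
        refine ⟨T.parent v, ?_, (hT v (by rwa [hρ])).symm⟩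
        rw [hℓ _ (hparent hvρ).2, hℓ x hxv, hout x hx', hout _ (hparent hvρ).1]
    · intro i
      rw [hℓv]
      by_cases hi : i = m
      · rw [hi]
      · rw [hcard]
        refine le_trans (Finset.card_le_card fun x => ?_) ((hm i).trans (Nat.le_succ _))
        simp only [Finset.mem_filter, Finset.mem_univ, true_and]
        intro hx
        have hxv : x ≠ v := by rintro rfl; exact hi (hx.symm.trans hℓv)
        exact ⟨hxv, by rw [← hℓ x hxv, hx]⟩

end Partition

/-- the routing bound of Alon et al.: on any connected graph on `n`
vertices, every permutation of the vertices can be realized as a composition of at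
most `3n` rounds of disjoint edge-transpositions. -/
theorem routing_bound {V : Type*} [Fintype V] [DecidableEq V]
    (G : SimpleGraph V) (hG : G.Connected) (π : Equiv.Perm V) :
    ∃ L : List (Equiv.Perm V),
      L.length ≤ 3 * Fintype.card V ∧
      (∀ σ ∈ L, IsRound G σ) ∧
      L.prod = π := by
  induction hn : Fintype.card V using Nat.strong_induction_on generalizing V with
  | _ n ih =>
  by_cases hn₂ : 2 ≤ Fintype.card V
  swap
  · have := Fintype.card_le_one_iff_subsingleton.1 (show Fintype.card V ≤ 1 by omega)
    exact ⟨[], by simp, by simp, Subsingleton.elim _ _⟩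
  obtain ⟨z, ℓ, hconn, hadj, hmax, hhalf⟩ := hG.exists_partition hn₂
  set K := (Finset.univ.filter fun x => ℓ x = ℓ z).card with hK
  have hKpos : 0 < K := Finset.card_pos.2 ⟨z, by simp⟩
  let H : SimpleGraph V :=
    { Adj := fun x y => G.Adj x y ∧ (ℓ x = ℓ y ∨ x = z ∨ y = z)
      symm := ⟨fun x y h => ⟨h.1.symm, by tauto⟩⟩
      loopless := ⟨fun x h => G.loopless.irrefl x h.1⟩ }
  have hHz : ∀ x, H.Reachable x z := by
    intro x
    let f : G.induce {y | ℓ y = ℓ x} →g H :=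
      ⟨Subtype.val, fun {a b} h => ⟨h, Or.inl (a.2.trans b.2.symm)⟩⟩
    have hfib : ∀ y, ℓ y = ℓ x → H.Reachable x y := fun y hy =>
      (hconn (ℓ x) ⟨x, rfl⟩ ⟨y, hy⟩).map f
    by_cases hx : ℓ x = ℓ z
    · exact hfib z hx.symm
    · obtain ⟨r, hr, hzr⟩ := hadj x hx
      have : H.Adj r z := ⟨hzr.symm, by simp⟩
      exact (hfib r hr).trans this.reachable
  have hH : H.Connected :=
    { preconnected := fun x y => (hHz x).trans (hHz y).symm
      nonempty := ⟨z⟩ }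
  obtain ⟨T, rfl, hT⟩ := hH.exists_parentTree z
  have hℓ : T.Respects ℓ := fun x hx => by
    rcases (hT x hx).2 with h | h | h
    · exact Or.inr h
    · exact Or.inl h
    · exact absurd h hx
  obtain ⟨L₁, hlen₁, hR₁, hp₁⟩ := T.exists_rounds_label_preserving hℓ
    (fun x hx => (hT x hx).1) π K hKpos fun x => (T.depth_le_card_fiber hℓ x).trans (hmax _)
  obtain ⟨L₂, hlen₂, hR₂, hp₂⟩ := exists_rounds_of_fibers (G := G) ℓ (3 * K) hp₁ fun i σ => by
    have hcard : Fintype.card {v // ℓ v = i} ≤ K := by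
      rw [Fintype.card_subtype]
      exact hmax i
    rcases isEmpty_or_nonempty {v // ℓ v = i} with he | he
    · exact ⟨[], by simp, by simp, Subsingleton.elim _ _⟩
    · obtain ⟨L, h₁, h₂⟩ := ih (Fintype.card {v // ℓ v = i}) (by omega) (V := {v // ℓ v = i})
        (G.comap Subtype.val)
        { preconnected := hconn i, nonempty := he } σ rfl
      exact ⟨L, by omega, h₂⟩
  refine ⟨L₂ ++ (L₁.map (·⁻¹)).reverse, ?_, ?_, ?_⟩
  · have hsum : K + (Finset.univ.filter fun x => ℓ x ≠ ℓ T.root).card = Fintype.card V :=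
      Finset.card_filter_add_card_filter_not _
    simp only [List.length_append, List.length_reverse, List.length_map]
    omega
  · intro σ hσ
    rcases List.mem_append.1 hσ with hσ | hσ
    · exact hR₂ σ hσ
    · obtain ⟨τ, hτ, rfl⟩ := List.mem_map.1 (List.mem_reverse.1 hσ)
      exact (hR₁ τ hτ).inv
  · rw [List.prod_append, ← List.prod_inv_reverse, hp₂, mul_inv_cancel_right]
end
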